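/- Let n ≥ 1 and let A be an n × n symmetric matrix over ℤ that is tridiagonal with all superdiagonal entries equal to 1 (that is, A i j = 0 whenever |i − j| ≥ 2, A i (i+1) = A (i+1) i = 1 for all i, and the diagonal entries e₁, …, eₙ are arbitrary integers). If det A = ±1, then A is congruent over ℤ to a block-diagonal matrix each of whose blocks is the 1 × 1 matrix (1), the 1 × 1 matrix (−1), or the 2 × 2 hyperbolic matrix [[0,1],[1,0]]; i.e., there exist U ∈ GL(n, ℤ) and natural numbers a, b, c with a + b + 2c = n such that Uᵀ A U is the direct sum of a copies of (1), b copies of (−1), and c copies of [[0,1],[1,0]]. -/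

import Mathlib

open Matrix

/-- The block-diagonal `n × n` integer matrix consisting (in order) of `a` copies of the
`1 × 1` block `(1)`, then `b` copies of the `1 × 1` block `(-1)`, and finally `2 × 2`
hyperbolic blocks `[[0,1],[1,0]]` filling the remaining `n - a - b` rows/columns. -/
def huckBlockForm (n a b : ℕ) : Matrix (Fin n) (Fin n) ℤ := fun i j =>
  if (i : ℕ) = (j : ℕ) then
    (if (i : ℕ) < a then 1 else if (i : ℕ) < a + b then -1 else 0)
  else if a + b ≤ (i : ℕ) ∧ a + b ≤ (j : ℕ) ∧
      (((i : ℕ) + 1 = (j : ℕ) ∧ ((i : ℕ) - (a + b)) % 2 = 0) ∨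
       ((j : ℕ) + 1 = (i : ℕ) ∧ ((j : ℕ) - (a + b)) % 2 = 0)) then 1
  else 0

section Congruence

variable {m n o : Type} [Fintype m] [DecidableEq m] [Fintype n] [DecidableEq n]
  [Fintype o] [DecidableEq o]

/-- Congruence of integer matrices over possibly different index types: `B = Pᵀ * A * P` with `P`
invertible over `ℤ`. -/
def IntCongr (A : Matrix m m ℤ) (B : Matrix n n ℤ) : Prop :=
  ∃ (P : Matrix m n ℤ) (Q : Matrix n m ℤ), P * Q = 1 ∧ Q * P = 1 ∧ Pᵀ * A * P = B

theorem IntCongr.trans {A : Matrix m m ℤ} {B : Matrix n n ℤ} {C : Matrix o o ℤ}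
    (hAB : IntCongr A B) (hBC : IntCongr B C) : IntCongr A C := by
  obtain ⟨P, Q, hPQ, hQP, rfl⟩ := hAB
  obtain ⟨R, S, hRS, hSR, rfl⟩ := hBC
  refine ⟨P * R, S * Q, ?_, ?_, ?_⟩
  · rw [Matrix.mul_assoc, ← Matrix.mul_assoc R, hRS, Matrix.one_mul, hPQ]
  · rw [Matrix.mul_assoc, ← Matrix.mul_assoc Q, hQP, Matrix.one_mul, hSR]
  · simp only [Matrix.transpose_mul, Matrix.mul_assoc]

theorem IntCongr.submatrix (A : Matrix m m ℤ) (e : n ≃ m) : IntCongr A (A.submatrix e e) := by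
  refine ⟨(1 : Matrix m m ℤ).submatrix id e, (1 : Matrix m m ℤ).submatrix e id, ?_, ?_, ?_⟩
  · rw [Matrix.submatrix_mul_equiv, Matrix.one_mul, Matrix.submatrix_id_id]
  · rw [← Matrix.submatrix_mul _ _ _ _ _ Function.bijective_id, Matrix.one_mul,
      Matrix.submatrix_one_equiv]
  · ext i j
    simp [Matrix.mul_apply, Matrix.one_apply]

theorem IntCongr.fromBlocks {m' n' : Type} [Fintype m'] [DecidableEq m'] [Fintype n']
    [DecidableEq n'] {A : Matrix m m ℤ} {B : Matrix n n ℤ} {A' : Matrix m' m' ℤ}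
    {B' : Matrix n' n' ℤ} (h : IntCongr A B) (h' : IntCongr A' B') :
    IntCongr (Matrix.fromBlocks A 0 0 A') (Matrix.fromBlocks B 0 0 B') := by
  obtain ⟨P, Q, hPQ, hQP, rfl⟩ := h
  obtain ⟨R, S, hRS, hSR, rfl⟩ := h'
  refine ⟨Matrix.fromBlocks P 0 0 R, Matrix.fromBlocks Q 0 0 S, ?_, ?_, ?_⟩ <;>
    simp [Matrix.fromBlocks_multiply, Matrix.fromBlocks_transpose, *]

theorem IntCongr.isUnit_det {A : Matrix m m ℤ} {B : Matrix n n ℤ} (h : IntCongr A B)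
    (hA : IsUnit A.det) : IsUnit B.det := by
  obtain ⟨P, Q, hPQ, hQP, rfl⟩ := h
  refine Matrix.isUnit_det_of_right_inverse (B := Q * A⁻¹ * Qᵀ) ?_
  calc Pᵀ * A * P * (Q * A⁻¹ * Qᵀ) = Pᵀ * (A * (P * Q) * A⁻¹) * Qᵀ := by
        simp only [Matrix.mul_assoc]
    _ = (Q * P)ᵀ := by
        rw [hPQ, Matrix.mul_one, Matrix.mul_nonsing_inv _ hA, Matrix.mul_one,
          Matrix.transpose_mul]
    _ = 1 := by rw [hQP, Matrix.transpose_one]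

theorem IntCongr.fromBlocks_schur {D E : Matrix m m ℤ} (B : Matrix m n ℤ) (C : Matrix n n ℤ)
    (hD : Dᵀ = D) (hDE : D * E = 1) :
    IntCongr (Matrix.fromBlocks D B Bᵀ C) (Matrix.fromBlocks D 0 0 (C - Bᵀ * E * B)) := by
  have hED : Eᵀ * D = 1 := by
    nth_rw 1 [← hD]
    rw [← Matrix.transpose_mul, hDE, Matrix.transpose_one]
  have hE : Eᵀ = E := by
    rw [← Matrix.mul_one Eᵀ, ← hDE, ← Matrix.mul_assoc, hED, Matrix.one_mul]
  rw [hE] at hED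
  refine ⟨Matrix.fromBlocks 1 (-(E * B)) 0 1, Matrix.fromBlocks 1 (E * B) 0 1, ?_, ?_, ?_⟩
  · simp [Matrix.fromBlocks_multiply]
  · simp [Matrix.fromBlocks_multiply]
  · have h1 : D * (E * B) = B := by rw [← Matrix.mul_assoc, hDE, Matrix.one_mul]
    have h2 : Bᵀ * (E * D) = Bᵀ := by rw [hED, Matrix.mul_one]
    simp [Matrix.fromBlocks_multiply, Matrix.fromBlocks_transpose, h1, h2, hE, Matrix.mul_assoc,
      sub_eq_neg_add]

end Congruence

section Splits

/-- The direct sum of copies of `(1)` indexed by `α`, copies of `(-1)` indexed by `β` and copies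
of the hyperbolic matrix indexed by `γ`. -/
def stdForm (α β γ : Type) [DecidableEq α] [DecidableEq β] [DecidableEq γ] :
    Matrix (α ⊕ β ⊕ γ × Fin 2) (α ⊕ β ⊕ γ × Fin 2) ℤ :=
  Matrix.fromBlocks 1 0 0 (Matrix.fromBlocks (-1) 0 0
    (Matrix.of fun p q => if p.1 = q.1 ∧ p.2 ≠ q.2 then 1 else 0))

/-- The matrix is congruent to a direct sum of copies of `(1)`, `(-1)` and the hyperbolic
matrix. -/
def Splits {ι : Type} [Fintype ι] [DecidableEq ι] (A : Matrix ι ι ℤ) : Prop :=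
  ∃ a b c : ℕ, IntCongr A (stdForm (Fin a) (Fin b) (Fin c))

variable {ι κ : Type} [Fintype ι] [DecidableEq ι] [Fintype κ] [DecidableEq κ]

theorem Splits.of_intCongr_stdForm {α β γ : Type} [Fintype α] [Fintype β] [Fintype γ]
    [DecidableEq α] [DecidableEq β] [DecidableEq γ] {A : Matrix ι ι ℤ}
    (h : IntCongr A (stdForm α β γ)) : Splits A := by
  let ea := (Fintype.equivFin α).symm
  let eb := (Fintype.equivFin β).symm
  let ec := (Fintype.equivFin γ).symm
  refine ⟨Fintype.card α, Fintype.card β, Fintype.card γ, h.trans ?_⟩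
  convert IntCongr.submatrix (stdForm α β γ)
    (ea.sumCongr (eb.sumCongr (ec.prodCongr (Equiv.refl (Fin 2))))) using 1
  ext (i | i | i) (j | j | j) <;> simp [stdForm, Matrix.one_apply]

theorem Splits.of_intCongr {A : Matrix ι ι ℤ} {B : Matrix κ κ ℤ} (h : IntCongr A B)
    (hB : Splits B) : Splits A := by
  obtain ⟨a, b, c, hB⟩ := hB
  exact ⟨a, b, c, h.trans hB⟩

theorem Splits.fromBlocks {A : Matrix ι ι ℤ} {B : Matrix κ κ ℤ} (hA : Splits A) (hB : Splits B) :
    Splits (Matrix.fromBlocks A 0 0 B) := by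
  obtain ⟨a, b, c, hA⟩ := hA
  obtain ⟨a', b', c', hB⟩ := hB
  let e : (Fin a ⊕ Fin a') ⊕ (Fin b ⊕ Fin b') ⊕ (Fin c ⊕ Fin c') × Fin 2 ≃
      (Fin a ⊕ Fin b ⊕ Fin c × Fin 2) ⊕ (Fin a' ⊕ Fin b' ⊕ Fin c' × Fin 2) :=
    (((Equiv.refl _).sumCongr (((Equiv.refl _).sumCongr (Equiv.sumProdDistrib _ _ _)).trans
      (Equiv.sumSumSumComm _ _ _ _))).trans (Equiv.sumSumSumComm _ _ _ _))
  refine Splits.of_intCongr_stdForm (α := Fin a ⊕ Fin a') (β := Fin b ⊕ Fin b')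
    (γ := Fin c ⊕ Fin c') ((hA.fromBlocks hB).trans ?_)
  convert IntCongr.submatrix _ e using 1
  ext ((i | i) | (i | i) | ⟨i | i, i'⟩) ((j | j) | (j | j) | ⟨j | j, j'⟩) <;>
    simp [stdForm, Matrix.one_apply, e]

theorem Splits.of_isEmpty [IsEmpty ι] (A : Matrix ι ι ℤ) : Splits A := by
  refine Splits.of_intCongr_stdForm (α := Empty) (β := Empty) (γ := Empty) ?_
  convert IntCongr.submatrix A (Equiv.equivOfIsEmpty (Empty ⊕ Empty ⊕ Empty × Fin 2) ι) using 1
  ext i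
  exact isEmptyElim i

theorem Splits.of_unique_one [Unique ι] {A : Matrix ι ι ℤ} (h : A default default = 1) :
    Splits A := by
  refine Splits.of_intCongr_stdForm (α := Unit) (β := Empty) (γ := Empty) ?_
  convert IntCongr.submatrix A
    ((Equiv.sumEmpty Unit (Empty ⊕ Empty × Fin 2)).trans (Equiv.ofUnique Unit ι)) using 1
  ext (i | ⟨⟨⟩⟩ | ⟨⟨⟩, -⟩) (j | ⟨⟨⟩⟩ | ⟨⟨⟩, -⟩)
  simp [stdForm, h]

theorem Splits.of_unique_neg_one [Unique ι] {A : Matrix ι ι ℤ} (h : A default default = -1) :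
    Splits A := by
  refine Splits.of_intCongr_stdForm (α := Empty) (β := Unit) (γ := Empty) ?_
  convert IntCongr.submatrix A ((Equiv.emptySum Empty (Unit ⊕ Empty × Fin 2)).trans
    ((Equiv.sumEmpty Unit (Empty × Fin 2)).trans (Equiv.ofUnique Unit ι))) using 1
  ext (⟨⟨⟩⟩ | i | ⟨⟨⟩, -⟩) (⟨⟨⟩⟩ | j | ⟨⟨⟩, -⟩)
  simp [stdForm, h]

theorem Splits.hyperbolic : Splits !![(0 : ℤ), 1; 1, 0] := by
  refine Splits.of_intCongr_stdForm (α := Empty) (β := Empty) (γ := Unit) ?_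
  convert IntCongr.submatrix !![(0 : ℤ), 1; 1, 0]
    ((Equiv.emptySum Empty (Empty ⊕ Unit × Fin 2)).trans
      ((Equiv.emptySum Empty (Unit × Fin 2)).trans (Equiv.punitProd (Fin 2)))) using 1
  ext (⟨⟨⟩⟩ | ⟨⟨⟩⟩ | ⟨-, i⟩) (⟨⟨⟩⟩ | ⟨⟨⟩⟩ | ⟨-, j⟩)
  fin_cases i <;> fin_cases j <;> simp [stdForm]

theorem Splits.diag_one_neg_one : Splits !![(1 : ℤ), 0; 0, -1] := by
  have h1 : Splits !![(1 : ℤ)] := Splits.of_unique_one rfl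
  have h2 : Splits !![(-1 : ℤ)] := Splits.of_unique_neg_one rfl
  refine Splits.of_intCongr ?_ (h1.fromBlocks h2)
  convert IntCongr.submatrix !![(1 : ℤ), 0; 0, -1] (finSumFinEquiv : Fin 1 ⊕ Fin 1 ≃ Fin 2) using 1
  ext (i | i) (j | j) <;> fin_cases i <;> fin_cases j <;> rfl

theorem Splits.of_isotropic {d : ℤ} (hd : d = 1 ∨ d = -1) (b : ℤ) : Splits !![0, d; d, b] := by
  have hdd : d * d = 1 := by rcases hd with rfl | rfl <;> rfl
  obtain ⟨k, rfl | rfl⟩ := Int.even_or_odd' b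
  · refine Splits.of_intCongr ⟨!![1, -k; 0, d], !![1, k * d; 0, d], ?_, ?_, ?_⟩ Splits.hyperbolic <;>
      ext i j <;> fin_cases i <;> fin_cases j <;> simp [Matrix.mul_apply, Fin.sum_univ_two] <;> grind
  · refine Splits.of_intCongr ⟨!![-k, 1 + k; d, -d], !![1, d * (1 + k); 1, d * k], ?_, ?_, ?_⟩
      Splits.diag_one_neg_one <;>
      ext i j <;> fin_cases i <;> fin_cases j <;> simp [Matrix.mul_apply, Fin.sum_univ_two] <;> grind

end Splits

section Tridiagonal

/-- A symmetric matrix over a linearly ordered index type whose entries at consecutive indices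
are `±1` and whose other off-diagonal entries vanish. -/
structure IsUnitTridiagonal {ι : Type} [LinearOrder ι] (A : Matrix ι ι ℤ) : Prop where
  symm : ∀ j k, A j k = A k j
  far : ∀ j m k, j < m → m < k → A j k = 0
  near : ∀ j k, j < k → (∀ m, j < m → ¬ m < k) → A j k = 1 ∨ A j k = -1

theorem Splits.of_schur {ι κ : Type} [Fintype ι] [DecidableEq ι] [Fintype κ] [DecidableEq κ]
    {A : Matrix ι ι ℤ} (hA : ∀ j k, A j k = A k j) (hdet : IsUnit A.det) {f : κ → ι}
    (hf : Function.Injective f) (hD : Splits (A.submatrix f f)) {E : Matrix κ κ ℤ}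
    (hE : A.submatrix f f * E = 1)
    (hS : ∀ S : Matrix {k // ∀ a, f a ≠ k} {k // ∀ a, f a ≠ k} ℤ,
      (∀ j k, S j k = A j k - ∑ b, (∑ a, A j (f a) * E a b) * A (f b) k) →
      IsUnit S.det → Splits S) : Splits A := by
  have hbij : Function.Bijective
      (Sum.elim f (Subtype.val : {k // ∀ a, f a ≠ k} → ι)) := by
    refine ⟨hf.sumElim Subtype.val_injective fun a k => k.2 a, fun k => ?_⟩
    by_cases h : ∀ a, f a ≠ k
    · exact ⟨Sum.inr ⟨k, h⟩, rfl⟩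
    · push Not at h
      exact ⟨Sum.inl h.choose, h.choose_spec⟩
  set g : {k // ∀ a, f a ≠ k} → ι := Subtype.val
  have h1 := IntCongr.submatrix A (Equiv.ofBijective _ hbij)
  have h2 : A.submatrix (Equiv.ofBijective _ hbij) (Equiv.ofBijective _ hbij) =
      Matrix.fromBlocks (A.submatrix f f) (A.submatrix f g) (A.submatrix f g)ᵀ
        (A.submatrix g g) := by
    ext (i | i) (j | j) <;> simp [hA]
  rw [h2] at h1
  have h3 := h1.trans (IntCongr.fromBlocks_schur _ _ (by ext i j; exact hA _ _) hE)
  have h4 := h3.isUnit_det hdet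
  rw [Matrix.det_fromBlocks_zero₂₁] at h4
  refine Splits.of_intCongr h3 (hD.fromBlocks (hS _ ?_ (isUnit_of_mul_isUnit_right h4)))
  intro j k
  simp [Matrix.mul_apply, hA, g]

variable {ι : Type} [LinearOrder ι] {A : Matrix ι ι ℤ}

theorem IsUnitTridiagonal.schur_unit (hA : IsUnitTridiagonal A) {i : ι}
    (hi : A i i = 1 ∨ A i i = -1) {p : ι → Prop} (hp : ∀ k, p k ↔ k ≠ i)
    {S : Matrix {k // p k} {k // p k} ℤ} (hS : ∀ j k, S j k = A j k - A i i * A j i * A i k) :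
    IsUnitTridiagonal S := by
  obtain ⟨hsymm, hfar, hnear⟩ := hA
  refine ⟨fun j k => ?_, ?_, ?_⟩
  · rw [hS, hS, hsymm j k, hsymm j i, hsymm i k]
    ring
  · rintro ⟨j, _⟩ ⟨m, hm⟩ ⟨k, _⟩ hjm hmk
    rw [hS]
    replace hjm : j < m := hjm
    replace hmk : m < k := hmk
    rcases ((hp m).mp hm).lt_or_gt with h | h
    · simp [hfar j m k hjm hmk, hfar j m i hjm h]
    · simp [hfar j m k hjm hmk, hfar i m k h hmk]
  · rintro ⟨j, hj⟩ ⟨k, hk⟩ hjk hempty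
    rw [hS]
    rw [hp] at hj hk
    replace hjk : j < k := hjk
    have hjm : ∀ m, m ≠ i → j < m → ¬ m < k := fun m hm => hempty ⟨m, (hp m).mpr hm⟩
    rcases hj.lt_or_gt with h | h
    · rcases hk.lt_or_gt with h' | h'
      · simpa [hfar j k i hjk h'] using
          hnear j k hjk fun m h1 h2 => hjm m (h2.trans h').ne h1 h2
      · have h1 := hnear j i h fun m h1 h2 => hjm m h2.ne h1 (h2.trans h')
        have h2 := hnear i k h' fun m h1 h2 => hjm m h1.ne' (h.trans h1) h2
        rw [hfar j i k h h']
        rcases hi with h0 | h0 <;> rcases h1 with h1 | h1 <;> rcases h2 with h2 | h2 <;>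
          simp [h0, h1, h2]
    · simpa [hfar i j k h hjk] using
        hnear j k hjk fun m h1 h2 => hjm m (h.trans h1).ne' h1 h2

theorem IsUnitTridiagonal.schur_isotropic (hA : IsUnitTridiagonal A) {i j : ι} (hij : i ≠ j)
    (hadj : ∀ m, ¬ (i < m ∧ m < j) ∧ ¬ (j < m ∧ m < i)) {p : ι → Prop}
    (hp : ∀ k, p k ↔ k ≠ i ∧ k ≠ j) {S : Matrix {k // p k} {k // p k} ℤ}
    (hS : ∀ k l, S k l = A k l + A j j * A k i * A i l - A i j * A k i * A j l
      - A i j * A k j * A i l) : IsUnitTridiagonal S := by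
  obtain ⟨hsymm, hfar, hnear⟩ := hA
  have hgt : ∀ m, m ≠ i → m ≠ j → (m < i ∧ m < j) ∨ (i < m ∧ j < m) := fun m h1 h2 => by
    have := hadj m
    rcases h1.lt_or_gt with h1 | h1 <;> rcases h2.lt_or_gt with h2 | h2 <;> tauto
  have hunit : ∀ x y z : ℤ, (x = 1 ∨ x = -1) → (y = 1 ∨ y = -1) → (z = 1 ∨ z = -1) →
      x * y * z = 1 ∨ x * y * z = -1 := by
    rintro x y z (rfl | rfl) (rfl | rfl) (rfl | rfl) <;> simp
  refine ⟨fun k l => ?_, ?_, ?_⟩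
  · rw [hS, hS, hsymm k l, hsymm k i, hsymm i l, hsymm k j, hsymm j l]
    ring
  · rintro ⟨k, _⟩ ⟨m, hm⟩ ⟨l, _⟩ hkm hml
    rw [hS]
    rw [hp] at hm
    replace hkm : k < m := hkm
    replace hml : m < l := hml
    rcases hgt m hm.1 hm.2 with ⟨h, h'⟩ | ⟨h, h'⟩
    · simp [hfar k m l hkm hml, hfar k m i hkm h, hfar k m j hkm h']
    · simp [hfar k m l hkm hml, hfar i m l h hml, hfar j m l h' hml]
  · rintro ⟨k, hk⟩ ⟨l, hl⟩ hkl hempty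
    rw [hS]
    rw [hp] at hk hl
    replace hkl : k < l := hkl
    have hklm : ∀ m, m ≠ i ∧ m ≠ j → k < m → ¬ m < l := fun m hm => hempty ⟨m, (hp m).mpr hm⟩
    rcases hgt k hk.1 hk.2 with ⟨hki, hkj⟩ | ⟨hik, hjk⟩
    · rcases hgt l hl.1 hl.2 with ⟨hli, hlj⟩ | ⟨hil, hjl⟩
      · simpa [hfar k l i hkl hli, hfar k l j hkl hlj] using
          hnear k l hkl fun m h1 h2 => hklm m ⟨(h2.trans hli).ne, (h2.trans hlj).ne⟩ h1 h2
      · rcases hij.lt_or_gt with h | h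
        · have h1 := hunit _ _ _ (hnear i j h fun m h1 h2 => (hadj m).1 ⟨h1, h2⟩)
            (hnear k i hki fun m h1 h2 => hklm m ⟨h2.ne, (h2.trans h).ne⟩ h1 (h2.trans hil))
            (hnear j l hjl fun m h1 h2 => hklm m ⟨(h.trans h1).ne', h1.ne'⟩ (hkj.trans h1) h2)
          rw [hfar k i l hki hil, hfar k i j hki h, hfar i j l h hjl]
          simpa [neg_eq_iff_eq_neg] using h1.symm
        · have h1 := hunit _ _ _ (hnear j i h fun m h1 h2 => (hadj m).2 ⟨h1, h2⟩)
            (hnear k j hkj fun m h1 h2 => hklm m ⟨(h2.trans h).ne, h2.ne⟩ h1 (h2.trans hjl))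
            (hnear i l hil fun m h1 h2 => hklm m ⟨h1.ne', (h.trans h1).ne'⟩ (hki.trans h1) h2)
          rw [hfar k i l hki hil, hfar k j i hkj h, hfar j i l h hil, hsymm i j]
          simpa [neg_eq_iff_eq_neg] using h1.symm
    · simpa [hfar i k l hik hkl, hfar j k l hjk hkl] using
        hnear k l hkl fun m h1 h2 => hklm m ⟨(hik.trans h1).ne', (hjk.trans h1).ne'⟩ h1 h2

theorem abs_sum_le_of_unique_ne_zero {κ : Type*} {s : Finset κ} {f : κ → ℤ} {C : ℤ} (hC : 0 ≤ C)
    (hf : ∀ j ∈ s, |f j| ≤ C) (h : ∀ j ∈ s, ∀ k ∈ s, j ≠ k → f j = 0 ∨ f k = 0) :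
    |∑ j ∈ s, f j| ≤ C := by
  by_cases h0 : ∃ j ∈ s, f j ≠ 0
  · obtain ⟨j, hj, hj0⟩ := h0
    rw [Finset.sum_eq_single_of_mem j hj fun k hk hkj => (h j hj k hk hkj.symm).resolve_left hj0]
    exact hf j hj
  · push Not at h0
    rw [Finset.sum_eq_zero h0, abs_zero]
    exact hC

theorem IsUnitTridiagonal.abs_le_one (hA : IsUnitTridiagonal A) {j k : ι} (hjk : j ≠ k) :
    |A j k| ≤ 1 := by
  have key : ∀ j k, j < k → |A j k| ≤ 1 := fun j k h => by
    by_cases hm : ∃ m, j < m ∧ m < k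
    · obtain ⟨m, h1, h2⟩ := hm
      simp [hA.far j m k h1 h2]
    · push Not at hm
      rcases hA.near j k h fun m h1 => (hm m h1).not_gt with h | h <;> simp [h]
  rcases hjk.lt_or_gt with h | h
  · exact key j k h
  · rw [hA.symm]
    exact key k j h

theorem IsUnitTridiagonal.abs_row_le [Fintype ι] (hA : IsUnitTridiagonal A) (x : ι → ℤ) (i : ι)
    {L R : ℤ} (hL : 0 ≤ L) (hR : 0 ≤ R) (hxL : ∀ j < i, |x j| ≤ L) (hxR : ∀ j, i < j → |x j| ≤ R) :
    |A i i| * |x i| ≤ |∑ j, A i j * x j| + L + R := by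
  have hsplit : ∑ j, A i j * x j = A i i * x i + ∑ j with j < i, A i j * x j
      + ∑ j with i < j, A i j * x j := by
    have hdiag : A i i * x i = ∑ j, if j = i then A i j * x j else 0 := by simp
    rw [Finset.sum_filter, Finset.sum_filter, hdiag, ← Finset.sum_add_distrib,
      ← Finset.sum_add_distrib]
    refine Finset.sum_congr rfl fun j _ => ?_
    rcases lt_trichotomy j i with h | rfl | h
    · simp [h, h.ne, h.not_gt]
    · simp
    · simp [h, h.ne', h.not_gt]
  have hmul : ∀ j C, i ≠ j → |x j| ≤ C → |A i j * x j| ≤ C := fun j C hij h => by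
    rw [abs_mul]
    exact (mul_le_of_le_one_left (abs_nonneg _) (hA.abs_le_one hij)).trans h
  have h1 : |∑ j with j < i, A i j * x j| ≤ L := by
    refine abs_sum_le_of_unique_ne_zero hL (fun j hj => ?_) fun j hj k hk hjk => ?_
    · rw [Finset.mem_filter] at hj
      exact hmul j L hj.2.ne' (hxL j hj.2)
    · rw [Finset.mem_filter] at hj hk
      rcases hjk.lt_or_gt with h | h
      · left; rw [hA.symm, hA.far j k i h hk.2, zero_mul]
      · right; rw [hA.symm, hA.far k j i h hj.2, zero_mul]
  have h2 : |∑ j with i < j, A i j * x j| ≤ R := by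
    refine abs_sum_le_of_unique_ne_zero hR (fun j hj => ?_) fun j hj k hk hjk => ?_
    · rw [Finset.mem_filter] at hj
      exact hmul j R hj.2.ne (hxR j hj.2)
    · rw [Finset.mem_filter] at hj hk
      rcases hjk.lt_or_gt with h | h
      · right; rw [hA.far i j k hj.2 h, zero_mul]
      · left; rw [hA.far i k j hk.2 h, zero_mul]
  rw [← abs_mul, hsplit]
  grind

theorem IsUnitTridiagonal.exists_abs_diag_le_one [Fintype ι] [Nonempty ι]
    (hA : IsUnitTridiagonal A) (hdet : IsUnit A.det) : ∃ i, |A i i| ≤ 1 := by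
  by_contra! hdiag
  obtain ⟨t, ht⟩ := Finite.exists_max (id : ι → ι)
  let x : ι → ℤ := fun j => A⁻¹ j t
  have hx : ∀ i, ∑ j, A i j * x j = if i = t then 1 else 0 := fun i => by
    rw [← Matrix.one_apply, ← Matrix.mul_nonsing_inv _ hdet, Matrix.mul_apply]
  obtain ⟨i₀, hi₀⟩ := Finite.exists_max fun j => |x j|
  have hpos : 1 ≤ |x i₀| := by
    by_contra! h
    have h0 : ∀ j, x j = 0 := fun j => abs_nonpos_iff.mp ((hi₀ j).trans (by omega))
    simpa [h0] using hx t
  obtain ⟨i, hi, hmin⟩ := Finset.exists_min_image (Finset.univ.filter fun j => |x j| = |x i₀|) id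
    ⟨i₀, by simp⟩
  simp only [Finset.mem_filter, Finset.mem_univ, true_and, id] at hi hmin
  have hL : ∀ j < i, |x j| ≤ |x i₀| - 1 := fun j hj => by
    have h1 : |x j| ≠ |x i₀| := fun h => (hmin j h).not_gt hj
    have h2 : |x j| ≤ |x i₀| := hi₀ j
    omega
  have hd : 2 * |x i₀| ≤ |A i i| * |x i| := by
    rw [hi]
    exact mul_le_mul_of_nonneg_right (hdiag i) (abs_nonneg _)
  by_cases hit : i = t
  · have := hA.abs_row_le x i (by omega) le_rfl hL fun j hj => ((ht j).not_gt (hit ▸ hj)).elim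
    rw [hx, if_pos hit, abs_one] at this
    omega
  · have := hA.abs_row_le x i (by omega) (abs_nonneg _) hL fun j _ => hi₀ j
    rw [hx, if_neg hit, abs_zero] at this
    omega

theorem exists_adjacent [Fintype ι] {i k : ι} (hik : k ≠ i) :
    ∃ j, i ≠ j ∧ ∀ m, ¬ (i < m ∧ m < j) ∧ ¬ (j < m ∧ m < i) := by
  rcases hik.lt_or_gt with h | h
  · obtain ⟨j, -, hj⟩ := exists_le_covBy_of_lt h
    exact ⟨j, hj.lt.ne', fun m =>
      ⟨fun hm => (hm.1.trans hm.2).not_gt hj.lt, fun hm => hj.2 hm.1 hm.2⟩⟩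
  · obtain ⟨j, hj, -⟩ := exists_covBy_le_of_lt h
    exact ⟨j, hj.lt.ne, fun m =>
      ⟨fun hm => hj.2 hm.1 hm.2, fun hm => (hm.1.trans hm.2).not_gt hj.lt⟩⟩

theorem IsUnitTridiagonal.splits [Fintype ι] (hA : IsUnitTridiagonal A) (hdet : IsUnit A.det) :
    Splits A := by
  induction hn : Fintype.card ι using Nat.strong_induction_on generalizing ι with
  | _ n ih =>
  cases isEmpty_or_nonempty ι
  · exact Splits.of_isEmpty A
  obtain ⟨i, hi⟩ := hA.exists_abs_diag_le_one hdet
  by_cases hi0 : A i i = 0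
  · by_cases hk : ∃ k, k ≠ i
    · obtain ⟨k, hk⟩ := hk
      obtain ⟨j, hij, hadj⟩ := exists_adjacent hk
      have hAij : A i j = 1 ∨ A i j = -1 := by
        rcases hij.lt_or_gt with h | h
        · exact hA.near i j h fun m h1 h2 => (hadj m).1 ⟨h1, h2⟩
        · rw [hA.symm]
          exact hA.near j i h fun m h1 h2 => (hadj m).2 ⟨h1, h2⟩
      have hsq : A i j * A i j = 1 := by rcases hAij with h | h <;> simp [h]
      have hD : A.submatrix ![i, j] ![i, j] = !![0, A i j; A i j, A j j] := by
        ext a b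
        fin_cases a <;> fin_cases b <;> simp [hi0, hA.symm j i]
      refine Splits.of_schur hA.symm hdet (f := ![i, j]) (E := !![-A j j, A i j; A i j, 0])
        ?_ ?_ ?_ ?_
      · intro a b
        fin_cases a <;> fin_cases b <;> simp [hij, hij.symm]
      · rw [hD]
        exact Splits.of_isotropic hAij _
      · rw [hD]
        ext a b
        fin_cases a <;> fin_cases b <;> simp [Matrix.mul_apply, hsq]
        ring
      · intro S hS hSdet
        have hlt : Fintype.card {k // ∀ a, ![i, j] a ≠ k} < n :=
          hn ▸ Fintype.card_subtype_lt (x := i) (by simp)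
        have := hA.schur_isotropic hij hadj (S := S)
          (fun k => by simp [Fin.forall_fin_two, eq_comm]) fun k l => by
            rw [hS]
            simp [Fin.sum_univ_two]
            ring
        convert ih _ hlt this (by convert hSdet) rfl
    · push Not at hk
      have : Unique ι := ⟨⟨i⟩, hk⟩
      rw [Matrix.det_unique, show (default : ι) = i from hk _, hi0] at hdet
      exact absurd hdet not_isUnit_zero
  · have hi1 : A i i = 1 ∨ A i i = -1 := by grind
    have hsq : A i i * A i i = 1 := by rcases hi1 with h | h <;> simp [h]
    refine Splits.of_schur hA.symm hdet (f := fun _ : Unit => i)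
      (E := Matrix.of fun _ _ => A i i) ?_ ?_ ?_ ?_
    · exact fun _ _ _ => rfl
    · exact hi1.elim (fun h => Splits.of_unique_one h) fun h => Splits.of_unique_neg_one h
    · ext
      simp [Matrix.mul_apply, hsq]
    · intro S hS hSdet
      have hlt : Fintype.card {k // ∀ _ : Unit, i ≠ k} < n :=
        hn ▸ Fintype.card_subtype_lt (x := i) (by simp)
      have := hA.schur_unit hi1 (S := S) (fun k => by simp [eq_comm]) fun k l => by
        rw [hS]
        simp [mul_comm (A k i)]
      convert ih _ hlt this (by convert hSdet) rfl

end Tridiagonal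

theorem stdForm_intCongr_huckBlockForm (a b c : ℕ) :
    IntCongr (stdForm (Fin a) (Fin b) (Fin c)) (huckBlockForm (a + (b + c * 2)) a b) := by
  let e : Fin a ⊕ Fin b ⊕ Fin c × Fin 2 ≃ Fin (a + (b + c * 2)) :=
    ((Equiv.refl _).sumCongr (((Equiv.refl _).sumCongr finProdFinEquiv).trans
      finSumFinEquiv)).trans finSumFinEquiv
  have h : stdForm (Fin a) (Fin b) (Fin c) =
      (huckBlockForm (a + (b + c * 2)) a b).submatrix e e := by
    ext (i | i | ⟨i, i'⟩) (j | j | ⟨j, j'⟩) <;>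
      simp only [stdForm, huckBlockForm, e, Matrix.one_apply, Fin.ext_iff,
        Matrix.fromBlocks_apply₁₁,
        Matrix.fromBlocks_apply₁₂, Matrix.fromBlocks_apply₂₁, Matrix.fromBlocks_apply₂₂,
        Matrix.submatrix_apply, Matrix.zero_apply, Matrix.neg_apply, Matrix.of_apply,
        Equiv.trans_apply, Equiv.sumCongr_apply, Sum.map_inl, Sum.map_inr, Equiv.coe_refl, id, ne_eq,
        finSumFinEquiv_apply_left, finSumFinEquiv_apply_right, Fin.val_castAdd, Fin.val_natAdd,
        finProdFinEquiv_apply_val] <;> grind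
  convert IntCongr.submatrix (stdForm (Fin a) (Fin b) (Fin c)) e.symm
  rw [h]
  simp

/-- Huck–Yoshida matrix lemma: a symmetric tridiagonal integer matrix with all
superdiagonal (and subdiagonal) entries equal to `1` and determinant `±1` is congruent
over `ℤ` to a direct sum of copies of `(1)`, `(-1)`, and `[[0,1],[1,0]]`. -/
theorem tridiagonal_unimodular_congruent_sum_of_rank_one_and_hyperbolic
    (n : ℕ) (hn : 1 ≤ n) (A : Matrix (Fin n) (Fin n) ℤ)
    (hzero : ∀ i j : Fin n, ((i : ℕ) + 2 ≤ (j : ℕ) ∨ (j : ℕ) + 2 ≤ (i : ℕ)) → A i j = 0)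
    (hone : ∀ i j : Fin n, (i : ℕ) + 1 = (j : ℕ) → A i j = 1 ∧ A j i = 1)
    (hdet : A.det = 1 ∨ A.det = -1) :
    ∃ (U : Matrix (Fin n) (Fin n) ℤ) (a b c : ℕ),
      IsUnit U.det ∧ a + b + 2 * c = n ∧ Uᵀ * A * U = huckBlockForm n a b := by
  obtain ⟨a, b, c, h⟩ := IsUnitTridiagonal.splits (A := A)
    ⟨fun j k => by grind, fun j m k h1 h2 => by grind, fun j k h1 h2 => by
      refine Or.inl (hone j k ?_).1
      by_contra hne
      exact h2 ⟨j + 1, by grind⟩ (by grind) (by grind)⟩ (Int.isUnit_iff.mpr hdet)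
  obtain ⟨U, V, hUV, hVU, hU⟩ := h.trans (stdForm_intCongr_huckBlockForm a b c)
  have hcard : n = a + (b + c * 2) := by
    simpa using (Matrix.square_of_invertible V U hVU hUV).symm
  subst hcard
  exact ⟨U, a, b, c, Matrix.isUnit_det_of_right_inverse hUV, by ring, hU⟩
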